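/- Let P be an uniplicit Markov kernel on a finite set V and let x0 ∈ H(P). Then the affine map K(P) ∋ K ↦ K(x0,·) ∈ K(P,x0) is injective: if K, K' ∈ K(P) satisfy K(x0,·) = K'(x0,·), then K = K'. -/

import Mathlib

open scoped BigOperators

/-- A Markov kernel on a finite set `V`: nonnegative entries, row sums equal to 1. -/
def IsMarkov {V : Type*} [Fintype V] (P : Matrix V V ℝ) : Prop :=
  (∀ x y, 0 ≤ P x y) ∧ ∀ x, ∑ y, P x y = 1

/-- Irreducibility: all entries of `∑_{n=1}^{|V|} P^n` are positive. -/
def IsIrreducibleKernel {V : Type*} [Fintype V] [DecidableEq V] (P : Matrix V V ℝ) : Prop :=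
  ∀ x y, 0 < ∑ n ∈ Finset.Icc 1 (Fintype.card V), (P ^ n) x y

/-- A probability measure on `V`, seen as a nonnegative vector of total mass 1. -/
def IsProbVec {V : Type*} [Fintype V] (m : V → ℝ) : Prop :=
  (∀ x, 0 ≤ m x) ∧ ∑ x, m x = 1

/-- A probability measure positive on all points of `V`. -/
def IsPositiveProb {V : Type*} [Fintype V] (μ : V → ℝ) : Prop :=
  (∀ x, 0 < μ x) ∧ ∑ x, μ x = 1

/-- Reversibility of `P` with respect to `μ`. -/
def IsReversible {V : Type*} (P : Matrix V V ℝ) (μ : V → ℝ) : Prop :=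
  ∀ x y, μ x * P x y = μ y * P y x

/-- `P` is uniplicit: reversible with respect to some positive probability, and all its
eigenvalues have multiplicity 1 (every eigenspace has dimension at most one). -/
def Uniplicit {V : Type*} [Fintype V] (P : Matrix V V ℝ) : Prop :=
  (∃ μ : V → ℝ, IsPositiveProb μ ∧ IsReversible P μ) ∧
  ∀ (θ : ℝ) (f g : V → ℝ), P.mulVec f = θ • f → P.mulVec g = θ • g →
    ∃ a b : ℝ, (a ≠ 0 ∨ b ≠ 0) ∧ a • f = b • g

/-- The Markov commutator of `P`: the Markov kernels commuting with `P`. -/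
def MarkovCommutator {V : Type*} [Fintype V] (P : Matrix V V ℝ) : Set (Matrix V V ℝ) :=
  {K | IsMarkov K ∧ K * P = P * K}

/-- `K(P,x)`: the set of rows at `x` of elements of the Markov commutator of `P`. -/
def commRows {V : Type*} [Fintype V] (P : Matrix V V ℝ) (x : V) : Set (V → ℝ) :=
  {m | ∃ K ∈ MarkovCommutator P, m = fun y => K x y}

/-- `H(P) := {x : K(P,x) = P(V)}`. -/
def HSet {V : Type*} [Fintype V] (P : Matrix V V ℝ) : Set V :=
  {x | commRows P x = {m | IsProbVec m}}

/-- The hypergroup property of `P` with respect to `μ` and the point `x0`. -/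
def HypergroupProperty {V : Type*} [Fintype V]
    (P : Matrix V V ℝ) (μ : V → ℝ) (x0 : V) : Prop :=
  ∃ φ : Fin (Fintype.card V) → V → ℝ,
    (∃ k1, ∀ x, φ k1 x = 1) ∧
    (∀ k l, ∑ x, μ x * φ k x * φ l x = if k = l then 1 else 0) ∧
    (∀ k, ∃ θ : ℝ, ∀ x, ∑ y, P x y * φ k y = θ * φ k x) ∧
    (∀ k, φ k x0 ≠ 0) ∧
    ∀ x y z, 0 ≤ ∑ k, φ k x * φ k y * φ k z / φ k x0

/-- `g` is a symmetry of `P`. -/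
def IsSymmetry {V : Type*} (P : Matrix V V ℝ) (g : Equiv.Perm V) : Prop :=
  ∀ x y, P (g x) (g y) = P x y


/-- A matrix annihilating every eigenvector of a kernel reversible with respect to a positive
measure is zero. -/
theorem IsReversible.eq_zero_of_mulVec_eigenvector_eq_zero
    {V : Type*} [Fintype V] [DecidableEq V] {P : Matrix V V ℝ} {μ : V → ℝ}
    (hμ : ∀ x, 0 < μ x) (hrev : IsReversible P μ) {M : Matrix V V ℝ}
    (hM : ∀ (θ : ℝ) (f : V → ℝ), P.mulVec f = θ • f → M.mulVec f = 0) : M = 0 := by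
  set r : V → ℝ := fun x => Real.sqrt (μ x) with hr
  have hr0 : ∀ x, r x ≠ 0 := fun x => (Real.sqrt_pos.2 (hμ x)).ne'
  have hrr : ∀ x, r x * r x = μ x := fun x => Real.mul_self_sqrt (hμ x).le
  let S : Matrix V V ℝ := Matrix.of fun x y => r x * P x y / r y
  have hS : S.IsHermitian := by
    ext x y
    have h := hrev x y
    rw [← hrr x, ← hrr y] at h
    have hx := hr0 x
    have hy := hr0 y
    simp only [S, Matrix.conjTranspose_apply, Matrix.of_apply, star_trivial]
    field_simp
    linarith
  have hvec : ∀ i x, ∑ y, M x y * (hS.eigenvectorBasis i y / r y) = 0 := by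
    intro i x
    refine congrFun (hM (hS.eigenvalues i) (fun y => hS.eigenvectorBasis i y / r y) ?_) x
    ext z
    have h := congrFun (hS.mulVec_eigenvectorBasis i) z
    simp only [Matrix.mulVec, dotProduct, S, Matrix.of_apply, Pi.smul_apply, smul_eq_mul] at h ⊢
    rw [← mul_div_assoc, ← h, Finset.sum_div]
    refine Finset.sum_congr rfl fun y _ => ?_
    have hz := hr0 z
    field_simp
  have hrow : ∀ x, WithLp.toLp 2 (fun y => M x y / r y) = (0 : EuclideanSpace ℝ V) := by
    intro x
    refine InnerProductSpace.ext_inner_right_basis hS.eigenvectorBasis.toBasis fun i => ?_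
    rw [inner_zero_left, OrthonormalBasis.coe_toBasis, ← hvec i x, PiLp.inner_apply]
    refine Finset.sum_congr rfl fun y _ => ?_
    simp
    ring
  ext x y
  have h := congrArg (fun v : EuclideanSpace ℝ V => v y) (hrow x)
  simpa [hr0 y] using h

/-- An operator commuting with a uniplicit kernel acts as a scalar on each eigenvector. -/
theorem Uniplicit.exists_mulVec_eq_smul
    {V : Type*} [Fintype V] {P A : Matrix V V ℝ} (hU : Uniplicit P) (hA : A * P = P * A)
    {θ : ℝ} {f : V → ℝ} (hf : P.mulVec f = θ • f) : ∃ a : ℝ, A.mulVec f = a • f := by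
  have hAf : P.mulVec (A.mulVec f) = θ • A.mulVec f := by
    rw [Matrix.mulVec_mulVec, ← hA, ← Matrix.mulVec_mulVec, hf, Matrix.mulVec_smul]
  obtain ⟨a, b, hab, h⟩ := hU.2 θ _ f hAf hf
  by_cases ha : a = 0
  · have hb : b ≠ 0 := hab.resolve_left fun h => h ha
    have hf0 : f = 0 := by
      rw [ha, zero_smul] at h
      exact (smul_eq_zero.1 h.symm).resolve_left hb
    exact ⟨0, by simp [hf0]⟩
  · exact ⟨a⁻¹ * b, by rw [mul_smul, ← h, inv_smul_smul₀ ha]⟩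

/-- The commutant of a uniplicit kernel is commutative. -/
theorem Uniplicit.mul_comm_of_commute
    {V : Type*} [Fintype V] [DecidableEq V] {P A B : Matrix V V ℝ} (hU : Uniplicit P)
    (hA : A * P = P * A) (hB : B * P = P * B) : A * B = B * A := by
  obtain ⟨μ, hμ, hrev⟩ := hU.1
  refine sub_eq_zero.1 (hrev.eq_zero_of_mulVec_eigenvector_eq_zero hμ.1 fun θ f hf => ?_)
  obtain ⟨a, ha⟩ := hU.exists_mulVec_eq_smul hA hf
  obtain ⟨b, hb⟩ := hU.exists_mulVec_eq_smul hB hf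
  rw [Matrix.sub_mulVec, ← Matrix.mulVec_mulVec, ← Matrix.mulVec_mulVec, ha, hb,
    Matrix.mulVec_smul, Matrix.mulVec_smul, ha, hb, smul_comm, sub_self]

/-- For an uniplicit Markov kernel `P` and `x0 ∈ H(P)`, the affine map
`K(P) ∋ K ↦ K(x0,·)` is injective. -/
theorem commutator_row_map_injective
    {V : Type*} [Fintype V] [DecidableEq V]
    (P : Matrix V V ℝ) (hP : IsMarkov P) (hU : Uniplicit P)
    (x0 : V) (hx0 : x0 ∈ HSet P) :
    ∀ K ∈ MarkovCommutator P, ∀ K' ∈ MarkovCommutator P,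
      (∀ y, K x0 y = K' x0 y) → K = K' := by
  intro K hK K' hK' hrow
  ext y z
  have hδ : IsProbVec (Pi.single y 1 : V → ℝ) :=
    ⟨fun x => by by_cases h : x = y <;> simp [h], by simp⟩
  obtain ⟨Q, hQ, hQrow⟩ : Pi.single y 1 ∈ commRows P x0 := by
    rw [show commRows P x0 = _ from hx0]
    exact hδ
  have key : ∀ L ∈ MarkovCommutator P, L y z = ∑ w, L x0 w * Q w z := by
    intro L hL
    have h := congrFun (congrFun (hU.mul_comm_of_commute hQ.2 hL.2) x0) z
    simp only [Matrix.mul_apply, ← congrFun hQrow] at h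
    simpa [Pi.single_apply] using h
  rw [key K hK, key K' hK']
  simp only [hrow]
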